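/- Let A be an m×n real matrix with columns a₁,…,aₙ, and let s ≥ 1. Suppose δ ≥ 0 satisfies the s-restricted isometry inequality for A, θ₁ ≥ 0 satisfies the (s,s)-restricted orthogonality inequality for A, θ₂ ≥ 0 satisfies the (s,2s)-restricted orthogonality inequality for A, and δ + θ₂ < 1. Let c ∈ ℝⁿ be supported on a set N ⊆ {1,…,n} with |N| ≤ s. Then there exists a vector γ ∈ ℝᵐ such that ⟨γ, aᵢ⟩ = cᵢ for all i ∈ N, and |⟨γ, aᵢ⟩| ≤ (θ₁ / ((1 − δ − θ₂)·√s)) · ‖c‖₂ for all i ∉ N. -/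

import Mathlib

open Classical Finset

/-- The 0-norm: number of nonzero components of a vector. -/
noncomputable def norm0 {n : ℕ} (z : Fin n → ℝ) : ℕ :=
  (Finset.univ.filter fun i => z i ≠ 0).card

/-- The 1-norm of a vector. -/
noncomputable def norm1 {n : ℕ} (z : Fin n → ℝ) : ℝ := ∑ i, |z i|

/-- `δ` satisfies the `k`-restricted isometry inequality for `A`. -/
def RIPineq {m n : ℕ} (A : Matrix (Fin m) (Fin n) ℝ) (k : ℕ) (δ : ℝ) : Prop :=
  ∀ z : Fin n → ℝ, norm0 z ≤ k →
    (1 - δ) * (∑ i, z i ^ 2) ≤ ∑ j, (A.mulVec z j) ^ 2 ∧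
      ∑ j, (A.mulVec z j) ^ 2 ≤ (1 + δ) * (∑ i, z i ^ 2)

/-- `θ` satisfies the `(s,s')`-restricted orthogonality inequality for `A`. -/
def ROineq {m n : ℕ} (A : Matrix (Fin m) (Fin n) ℝ) (s s' : ℕ) (θ : ℝ) : Prop :=
  ∀ u v : Fin n → ℝ, (∀ i, u i = 0 ∨ v i = 0) → norm0 u ≤ s → norm0 v ≤ s' →
    |∑ j, A.mulVec u j * A.mulVec v j| ≤
      θ * Real.sqrt (∑ i, u i ^ 2) * Real.sqrt (∑ i, v i ^ 2)

/-- The restriction of `z` to the index set `S` (zero outside `S`). -/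
noncomputable def restrict {n : ℕ} (z : Fin n → ℝ) (S : Finset (Fin n)) : Fin n → ℝ :=
  fun i => if i ∈ S then z i else 0

theorem top_set {n : ℕ} (f : Fin n → ℝ) (S : Finset (Fin n)) (k : ℕ) (hk : k ≤ S.card) :
    ∃ T ⊆ S, T.card = k ∧ ∀ i ∈ T, ∀ j ∈ S \ T, f j ≤ f i := by
  induction k with
  | zero => exact ⟨∅, by simp, by simp, by simp⟩
  | succ k ih =>
    obtain ⟨T, hTS, hc, hT⟩ := ih (by omega)
    have hne : (S \ T).Nonempty := by
      rw [← Finset.card_pos, Finset.card_sdiff_of_subset hTS]; omega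
    obtain ⟨x, hx, hmax⟩ := Finset.exists_max_image (S \ T) f hne
    have hx' := Finset.mem_sdiff.1 hx
    refine ⟨insert x T, ?_, ?_, ?_⟩
    · exact Finset.insert_subset hx'.1 hTS
    · rw [Finset.card_insert_of_notMem hx'.2, hc]
    · intro i hi j hj
      have hj' : j ∈ S \ T := by
        simp only [Finset.mem_sdiff, Finset.mem_insert, not_or] at hj ⊢
        exact ⟨hj.1, hj.2.2⟩
      rcases Finset.mem_insert.1 hi with rfl | hi
      · exact hmax j hj'
      · exact hT i hi j hj'

theorem top_set' {n : ℕ} (f : Fin n → ℝ) (hf : ∀ i, 0 ≤ f i) (S : Finset (Fin n)) (s : ℕ)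
    (hs : 1 ≤ s) :
    ∃ T ⊆ S, T.card ≤ s ∧ (S.Nonempty → T.Nonempty) ∧
      ∃ M : ℝ, 0 ≤ M ∧ s * M ≤ ∑ i ∈ T, f i ∧ ∀ j ∈ S \ T, f j ≤ M := by
  by_cases h : S.card ≤ s
  · exact ⟨S, subset_rfl, h, id, 0, le_rfl, by
      simpa using Finset.sum_nonneg (fun i _ => hf i), by simp⟩
  · obtain ⟨T, hTS, hc, hT⟩ := top_set f S s (by omega)
    have hne : (S \ T).Nonempty := by
      rw [← Finset.card_pos, Finset.card_sdiff_of_subset hTS]; omega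
    obtain ⟨x, hx, hmax⟩ := Finset.exists_max_image (S \ T) f hne
    refine ⟨T, hTS, hc.le, fun _ => Finset.card_pos.1 (by omega), f x, hf x, ?_, hmax⟩
    rw [← hc, ← nsmul_eq_mul]
    exact Finset.card_nsmul_le_sum T f (f x) (fun i hi => hT i hi x hx)

/-- The form `⟨Au, Av⟩`. -/
noncomputable def gform {m n : ℕ} (A : Matrix (Fin m) (Fin n) ℝ) (u v : Fin n → ℝ) : ℝ :=
  ∑ j, A.mulVec u j * A.mulVec v j

/-- Euclidean norm. -/
noncomputable def nrm2 {n : ℕ} (u : Fin n → ℝ) : ℝ := Real.sqrt (∑ i, u i ^ 2)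

theorem gform_add {m n : ℕ} (A : Matrix (Fin m) (Fin n) ℝ) (u v w : Fin n → ℝ) :
    gform A u (v + w) = gform A u v + gform A u w := by
  simp [gform, Matrix.mulVec_add, mul_add, Finset.sum_add_distrib]

theorem restrict_split {n : ℕ} (z : Fin n → ℝ) {S T : Finset (Fin n)} (h : T ⊆ S) :
    restrict z S = restrict z T + restrict z (S \ T) := by
  funext i
  have := @h i
  by_cases h1 : i ∈ T
  · simp [_root_.restrict, h1, this h1]
  · by_cases h2 : i ∈ S <;> simp [_root_.restrict, h1, h2]

theorem norm0_restrict {n : ℕ} (z : Fin n → ℝ) (S : Finset (Fin n)) :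
    norm0 (restrict z S) ≤ S.card := by
  apply Finset.card_le_card
  intro i hi
  by_contra h
  simp [_root_.restrict, h] at hi

theorem nrm2_sq {n : ℕ} (u : Fin n → ℝ) : nrm2 u ^ 2 = ∑ i, u i ^ 2 :=
  Real.sq_sqrt (Finset.sum_nonneg fun i _ => sq_nonneg _)

theorem nrm2_restrict_le {n : ℕ} (z : Fin n → ℝ) (T : Finset (Fin n)) (s : ℕ) (M : ℝ)
    (hM : 0 ≤ M) (hT : T.card ≤ s) (h : ∀ i ∈ T, |z i| ≤ M) :
    nrm2 (restrict z T) ≤ Real.sqrt s * M := by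
  unfold nrm2
  rw [Real.sqrt_le_left (by positivity), mul_pow, Real.sq_sqrt (by positivity)]
  have : ∑ i, restrict z T i ^ 2 = ∑ i ∈ T, z i ^ 2 := by
    simp [_root_.restrict, ite_pow, Finset.sum_ite_mem]
  rw [this]
  calc ∑ i ∈ T, z i ^ 2 ≤ ∑ i ∈ T, M ^ 2 := by
        apply Finset.sum_le_sum
        intro i hi
        exact sq_le_sq' (abs_le.1 (h i hi)).1 (abs_le.1 (h i hi)).2
    _ = T.card * M ^ 2 := by simp
    _ ≤ s * M ^ 2 := by gcongr

theorem tail_bound {m n : ℕ} (A : Matrix (Fin m) (Fin n) ℝ) (s : ℕ) (hs : 1 ≤ s) (θ : ℝ)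
    (hθ : 0 ≤ θ) (hRO : ROineq A s s θ) (u z : Fin n → ℝ) (hu : norm0 u ≤ s) (k : ℕ) :
    ∀ (S : Finset (Fin n)) (M : ℝ), S.card ≤ k → 0 ≤ M → (∀ i ∈ S, u i = 0) →
      (∀ i ∈ S, |z i| ≤ M) →
      |gform A u (restrict z S)| ≤
        θ * nrm2 u * (Real.sqrt s * M + (∑ i ∈ S, |z i|) / Real.sqrt s) := by
  have hspos : (0 : ℝ) < s := by exact_mod_cast hs
  have hsq : 0 < Real.sqrt s := Real.sqrt_pos.2 hspos
  have hnu : 0 ≤ nrm2 u := Real.sqrt_nonneg _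
  induction k with
  | zero =>
    intro S M hc hM _ _
    have : S = ∅ := Finset.card_eq_zero.1 (by omega)
    subst this
    have : restrict z ∅ = 0 := by funext i; simp [_root_.restrict]
    rw [this]
    simp [gform]
    positivity
  | succ k ih =>
    intro S M hc hM huS hz
    obtain ⟨T, hTS, hTc, hTne, M', hM', hsM, hMj⟩ :=
      top_set' (fun i => |z i|) (fun i => abs_nonneg _) S s hs
    by_cases hSk : S.card ≤ k
    · exact ih S M hSk hM huS hz
    have hSne : S.Nonempty := Finset.card_pos.1 (by omega)
    have hTpos := Finset.card_pos.2 (hTne hSne)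
    have h1 := ih (S \ T) M' (by rw [Finset.card_sdiff_of_subset hTS]; omega) hM'
      (fun i hi => huS i (Finset.mem_sdiff.1 hi).1) hMj
    have h2 : |gform A u (restrict z T)| ≤ θ * nrm2 u * nrm2 (restrict z T) := by
      apply hRO u (restrict z T) _ hu ((norm0_restrict z T).trans hTc)
      intro i
      by_cases hi : i ∈ T
      · exact Or.inl (huS i (hTS hi))
      · right; simp [_root_.restrict, hi]
    have h3 := nrm2_restrict_le z T s M hM hTc (fun i hi => hz i (hTS hi))
    rw [restrict_split z hTS, gform_add, ← Finset.sum_sdiff hTS]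
    have h4 : Real.sqrt s * M' ≤ (∑ i ∈ T, |z i|) / Real.sqrt s := by
      rw [le_div_iff₀ hsq]
      calc Real.sqrt s * M' * Real.sqrt s = (Real.sqrt s * Real.sqrt s) * M' := by ring
        _ = s * M' := by rw [Real.mul_self_sqrt hspos.le]
        _ ≤ _ := hsM
    calc _ ≤ |gform A u (restrict z T)| + |gform A u (restrict z (S \ T))| := abs_add_le _ _
      _ ≤ θ * nrm2 u * (Real.sqrt s * M) + θ * nrm2 u *
          ((∑ i ∈ T, |z i|) / Real.sqrt s + (∑ i ∈ S \ T, |z i|) / Real.sqrt s) := by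
        refine add_le_add (h2.trans ?_) (h1.trans ?_) <;> gcongr
      _ = _ := by ring

theorem ker_bound {m n : ℕ} (A : Matrix (Fin m) (Fin n) ℝ)
    (s : ℕ) (hs : 1 ≤ s) (δ θ₁ θ₂ : ℝ)
    (hθ₁0 : 0 ≤ θ₁) (hθ₂0 : 0 ≤ θ₂)
    (hRIP : RIPineq A s δ)
    (hRO1 : ROineq A s s θ₁)
    (hRO2 : ROineq A s (2 * s) θ₂)
    (hsum : δ + θ₂ < 1) (N : Finset (Fin n)) (hN : N.card ≤ s)
    (z : Fin n → ℝ) (hz : A.mulVec z = 0) :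
    nrm2 (restrict z N) ≤ θ₁ / ((1 - δ - θ₂) * Real.sqrt s) * ∑ i ∈ Nᶜ, |z i| := by
  have hspos : (0 : ℝ) < s := by exact_mod_cast hs
  have hsq : 0 < Real.sqrt s := Real.sqrt_pos.2 hspos
  obtain ⟨T, hTS, hTc, -, M, hM, hsM, hMj⟩ :=
    top_set' (fun i => |z i|) (fun i => abs_nonneg _) Nᶜ s hs
  set R := Nᶜ \ T with hR
  set L := ∑ i ∈ Nᶜ, |z i| with hL
  have hTN : ∀ i ∈ T, i ∉ N := fun i hi => Finset.mem_compl.1 (hTS hi)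
  have hzsplit : z = restrict z N + (restrict z T + restrict z R) := by
    rw [← restrict_split z hTS]
    funext i
    by_cases h : i ∈ N <;> simp [_root_.restrict, h]
  have hL' : Real.sqrt s * M + (∑ i ∈ R, |z i|) / Real.sqrt s ≤ L / Real.sqrt s := by
    rw [hL, ← Finset.sum_sdiff hTS, add_div, add_comm]
    gcongr
    rw [le_div_iff₀ hsq]
    calc Real.sqrt s * M * Real.sqrt s = (Real.sqrt s * Real.sqrt s) * M := by ring
      _ = s * M := by rw [Real.mul_self_sqrt hspos.le]
      _ ≤ _ := hsM
  -- the common estimate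
  have key : ∀ P Q : Finset (Fin n), P.card ≤ s → Q.card ≤ s → (∀ i ∈ P, i ∉ Q) →
      (∀ i ∈ R, i ∉ P) → z = restrict z P + (restrict z Q + restrict z R) →
      nrm2 (restrict z Q) ≤ nrm2 (restrict z P) →
      (1 - δ - θ₂) * nrm2 (restrict z P) ≤ θ₁ * (L / Real.sqrt s) := by
    intro P Q hP hQ hPQ hRP hsplit hle
    set u := restrict z P with hu
    have hu0 : norm0 u ≤ s := (norm0_restrict z P).trans hP
    have hnu : 0 ≤ nrm2 u := Real.sqrt_nonneg _
    have h0 : gform A u u + (gform A u (restrict z Q) + gform A u (restrict z R)) = 0 := by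
      rw [← gform_add, ← gform_add, ← hsplit]
      simp [gform, hz]
    have h1 : (1 - δ) * nrm2 u ^ 2 ≤ gform A u u := by
      rw [nrm2_sq]
      have := (hRIP u hu0).1
      simpa only [gform, sq] using this
    have h2 : |gform A u (restrict z Q)| ≤ θ₂ * nrm2 u * nrm2 (restrict z Q) := by
      apply hRO2 u _ _ hu0 (((norm0_restrict z Q).trans hQ).trans (by omega))
      intro i
      by_cases hi : i ∈ P
      · right; simp [_root_.restrict, hPQ i hi]
      · left; simp [hu, _root_.restrict, hi]
    have h3 := tail_bound A s hs θ₁ hθ₁0 hRO1 u z hu0 R.card R M le_rfl hM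
      (fun i hi => by simp [hu, _root_.restrict, hRP i hi]) hMj
    have h4 : |gform A u (restrict z R)| ≤ θ₁ * nrm2 u * (L / Real.sqrt s) :=
      h3.trans (by gcongr)
    have h5 : |gform A u (restrict z Q)| ≤ θ₂ * nrm2 u * nrm2 u := h2.trans (by gcongr)
    have h6 := (abs_le.1 h4).1
    have h7 := (abs_le.1 h5).1
    rcases hnu.eq_or_lt with h | h
    · rw [← h]
      have : 0 ≤ L := Finset.sum_nonneg fun i _ => abs_nonneg _
      simp only [mul_zero]; positivity
    · refine le_of_mul_le_mul_right ?_ h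
      nlinarith
  have hd : 0 < 1 - δ - θ₂ := by linarith
  have fin : (1 - δ - θ₂) * nrm2 (restrict z N) ≤ θ₁ * (L / Real.sqrt s) := by
    rcases le_total (nrm2 (restrict z T)) (nrm2 (restrict z N)) with h | h
    · refine key N T hN hTc (fun i hi hi' => hTN i hi' hi) ?_ hzsplit h
      intro i hi
      exact Finset.mem_compl.1 (Finset.mem_sdiff.1 hi).1
    · refine le_trans (by gcongr) (key T N hTc hN hTN ?_ ?_ h)
      · intro i hi
        exact (Finset.mem_sdiff.1 hi).2
      · rw [add_left_comm]; exact hzsplit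
  have : θ₁ / ((1 - δ - θ₂) * Real.sqrt s) * L = θ₁ * (L / Real.sqrt s) / (1 - δ - θ₂) := by
    field_simp
  rw [this, le_div_iff₀ hd]
  linarith

theorem stmt_2 {m n : ℕ} (A : Matrix (Fin m) (Fin n) ℝ)
    (s : ℕ) (hs : 1 ≤ s) (δ θ₁ θ₂ : ℝ)
    (hδ0 : 0 ≤ δ) (hθ₁0 : 0 ≤ θ₁) (hθ₂0 : 0 ≤ θ₂)
    (hRIP : RIPineq A s δ)
    (hRO1 : ROineq A s s θ₁)
    (hRO2 : ROineq A s (2 * s) θ₂)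
    (hsum : δ + θ₂ < 1)
    (c : Fin n → ℝ) (N : Finset (Fin n)) (hsupp : ∀ i, i ∉ N → c i = 0)
    (hN : N.card ≤ s) :
    ∃ γ : Fin m → ℝ,
      (∀ i ∈ N, (∑ j, γ j * A j i) = c i) ∧
      (∀ i ∉ N, |∑ j, γ j * A j i| ≤
        θ₁ / ((1 - δ - θ₂) * Real.sqrt s) * Real.sqrt (∑ i, c i ^ 2)) := by
  have hd : 0 < 1 - δ - θ₂ := by linarith
  set B := θ₁ / ((1 - δ - θ₂) * Real.sqrt s) with hB
  have hB0 : 0 ≤ B := by positivity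
  set C := Real.sqrt (∑ i, c i ^ 2) with hC
  have hC0 : 0 ≤ C := Real.sqrt_nonneg _
  let p : (Fin n → ℝ) → ℝ := fun z => ∑ i, c i * z i + B * C * ∑ i ∈ Nᶜ, |z i|
  let K : Submodule ℝ (Fin n → ℝ) := LinearMap.ker A.mulVecLin
  have hp : ∀ z ∈ K, 0 ≤ p z := by
    intro z hz
    have hz' : A.mulVec z = 0 := by simpa [K] using hz
    have h1 := ker_bound A s hs δ θ₁ θ₂ hθ₁0 hθ₂0 hRIP hRO1 hRO2 hsum N hN z hz'
    have h2 : ∑ i, c i * z i = ∑ i, c i * restrict z N i := by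
      apply Finset.sum_congr rfl
      intro i _
      by_cases h : i ∈ N
      · simp [_root_.restrict, h]
      · simp [hsupp i h]
    have h3 := Real.sum_mul_le_sqrt_mul_sqrt Finset.univ (fun i => - c i) (restrict z N)
    simp only [neg_mul, Finset.sum_neg_distrib, neg_sq] at h3
    have h4 : C * nrm2 (restrict z N) ≤ C * (B * ∑ i ∈ Nᶜ, |z i|) := by gcongr
    have h5 : -∑ i, c i * restrict z N i ≤ C * nrm2 (restrict z N) := h3
    simp only [p]
    rw [h2]
    linarith
  obtain ⟨g, hg0, hgp⟩ := exists_extension_of_le_sublinear ⟨K, 0⟩ p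
    (by
      intro r hr z
      simp only [p, Pi.smul_apply, smul_eq_mul, abs_mul, abs_of_pos hr, mul_add, Finset.mul_sum]
      congr 1 <;> exact Finset.sum_congr rfl fun i _ => by ring)
    (by
      intro x y
      have : ∑ i ∈ Nᶜ, |x i + y i| ≤ ∑ i ∈ Nᶜ, |x i| + ∑ i ∈ Nᶜ, |y i| := by
        rw [← Finset.sum_add_distrib]
        exact Finset.sum_le_sum fun i _ => abs_add_le _ _
      have h' : B * C * ∑ i ∈ Nᶜ, |x i + y i| ≤
        B * C * (∑ i ∈ Nᶜ, |x i| + ∑ i ∈ Nᶜ, |y i|) := by gcongr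
      simp only [p, Pi.add_apply, mul_add, Finset.sum_add_distrib] at h' ⊢
      linarith)
    (by
      intro z
      exact hp z.1 z.2)
  have hgK : g ∈ (LinearMap.ker A.mulVecLin).dualAnnihilator := by
    rw [Submodule.mem_dualAnnihilator]
    intro z hz
    exact hg0 ⟨z, hz⟩
  rw [← LinearMap.range_dualMap_eq_dualAnnihilator_ker] at hgK
  obtain ⟨φ, hφ⟩ := hgK
  have hval : ∀ i, ∑ j, φ (Pi.single j 1) * A j i = g (Pi.single i 1) := by
    intro i
    rw [← hφ, LinearMap.dualMap_apply, Matrix.mulVecLin_apply, Matrix.mulVec_single_one,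
      LinearMap.pi_apply_eq_sum_univ φ]
    refine Finset.sum_congr rfl fun j _ => ?_
    rw [smul_eq_mul, mul_comm]
    congr 2
    funext k
    simp [Pi.single_apply, eq_comm]
  have hpp : ∀ i, ∀ r : ℝ, p (Pi.single i r) = c i * r + B * C * (if i ∈ N then 0 else |r|) := by
    intro i r
    simp only [p]
    congr 1
    · simp [Pi.single_apply]
    · congr 1
      have : ∀ k, |(Pi.single i r : Fin n → ℝ) k| = if k = i then |r| else 0 := by
        intro k
        by_cases h : k = i <;> simp [Pi.single_apply, h]
      simp only [this, Finset.sum_ite_eq', Finset.mem_compl]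
      by_cases h : i ∈ N <;> simp [h]
  have hub : ∀ i, g (Pi.single i 1) ≤ c i + B * C * (if i ∈ N then 0 else 1) := by
    intro i
    have := hgp (Pi.single i 1)
    rw [hpp] at this
    simpa using this
  have hlb : ∀ i, -g (Pi.single i 1) ≤ -c i + B * C * (if i ∈ N then 0 else 1) := by
    intro i
    have := hgp (Pi.single i (-1))
    rw [hpp, Pi.single_neg, map_neg] at this
    simpa using this
  refine ⟨fun j => φ (Pi.single j 1), ?_, ?_⟩
  · intro i hi
    have h1 := hub i
    have h2 := hlb i
    simp only [hi, if_true, mul_zero, add_zero] at h1 h2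
    rw [hval]
    linarith
  · intro i hi
    have h1 := hub i
    have h2 := hlb i
    simp only [hi, if_false, mul_one, hsupp i hi] at h1 h2
    rw [hval, abs_le]
    constructor <;> linarith
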